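/- With L = log(2π), the series ∑_{k=0}^∞ 1/β_k⁴ converges and ∑_{k=0}^∞ 1/β_k⁴ = 2ζ(3)(L+1) + γ⁴ + π⁴/9 + (π²/6)(L² + 3) + 2γ³(L+1) + (γ/6)·[24ζ(3) + 3 + 4π²(L+1) + 3L(L² − L + 7)] + (γ²/6)·[9L² + 6L + 4π² + 21] + (1/16)·[L⁴ − 4L³ + 22L² − 36L + 49], where ζ(3) is the value of the Riemann zeta function at 3. -/

import Mathlib

/-- The logarithmic derivative `ψ_G = G'/G` of the Barnes `G` function, expressed via the
Digamma function `ψ = Γ'/Γ` as `ψ_G(z) = (log 2π + 1)/2 - z + (z-1)ψ(z)`. -/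
noncomputable def psiG (z : ℂ) : ℂ :=
  ((Real.log (2 * Real.pi) : ℂ) + 1) / 2 - z + (z - 1) * logDeriv Complex.Gamma z

section

open Real Set Filter Topology

/-- The logarithmic derivative of the complex Gamma function restricts to the real one. -/
lemma logDeriv_Gamma_ofReal {x : ℝ} (hx : ∀ n : ℕ, x ≠ -(n : ℝ)) :
    logDeriv Complex.Gamma (x : ℂ) = ((logDeriv Real.Gamma x : ℝ) : ℂ) := by
  have hc : HasDerivAt Complex.Gamma (deriv Complex.Gamma x) (x : ℂ) :=
    (Complex.differentiableAt_Gamma _ fun m => by exact_mod_cast hx m).hasDerivAt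
  have hr := (Real.differentiableAt_Gamma hx).hasDerivAt.ofReal_comp
  have hd : deriv Complex.Gamma x = ((deriv Real.Gamma x : ℝ) : ℂ) := by
    refine hc.comp_ofReal.unique ?_
    simpa only [Complex.Gamma_ofReal] using hr
  rw [logDeriv_apply, logDeriv_apply, hd, Complex.Gamma_ofReal]
  push_cast
  rfl

lemma logDeriv_Gamma_add_one {x : ℝ} (hx : ∀ n : ℕ, x ≠ -(n : ℝ)) :
    logDeriv Real.Gamma (x + 1) = logDeriv Real.Gamma x + 1 / x := by
  have hx' : ∀ n : ℕ, x + 1 ≠ -(n : ℝ) := fun n h => hx (n + 1) (by push_cast; linarith)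
  have h := Complex.digamma_apply_add_one (x : ℂ) fun m => by exact_mod_cast hx m
  have h1 : (x : ℂ) + 1 = ((x + 1 : ℝ) : ℂ) := by push_cast; rfl
  rw [Complex.digamma_def, h1, logDeriv_Gamma_ofReal hx, logDeriv_Gamma_ofReal hx'] at h
  rw [one_div]
  exact_mod_cast h

lemma logDeriv_Gamma_add_nat {x : ℝ} (hx : ∀ n : ℕ, x ≠ -(n : ℝ)) (m : ℕ) :
    logDeriv Real.Gamma (x + m) = logDeriv Real.Gamma x + ∑ n ∈ Finset.range m, 1 / (x + n) := by
  induction m with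
  | zero => simp
  | succ m ih =>
    have hm : ∀ n : ℕ, x + m ≠ -(n : ℝ) := fun n h => hx (m + n) (by push_cast; linarith)
    rw [Nat.cast_succ, ← add_assoc, logDeriv_Gamma_add_one hm, ih, Finset.sum_range_succ, add_assoc]

lemma logDeriv_Gamma_mem_Icc {x : ℝ} (hx : 0 < x) :
    logDeriv Real.Gamma (x + 1) ∈ Icc (log x) (log (x + 1)) := by
  have hc : ConvexOn ℝ (Ioi 0) (log ∘ Gamma) := convexOn_log_Gamma
  have h_rec (y : ℝ) (hy : 0 < y) :
      (log ∘ Gamma) (y + 1) = (log ∘ Gamma) y + log y := by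
    simp only [Function.comp_apply, Gamma_add_one hy.ne', log_mul hy.ne' (Gamma_pos_of_pos hy).ne',
      add_comm]
  have hne : ∀ m : ℕ, x + 1 ≠ -(m : ℝ) := fun m => by
    have : (0 : ℝ) ≤ m := m.cast_nonneg
    intro h; linarith
  have hd : DifferentiableAt ℝ (log ∘ Gamma) (x + 1) :=
    (differentiableAt_Gamma hne).log (Gamma_ne_zero hne)
  have hder : deriv (log ∘ Gamma) (x + 1) = logDeriv Gamma (x + 1) := by
    rw [Function.comp_def, deriv.log (differentiableAt_Gamma hne) (Gamma_ne_zero hne),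
      logDeriv_apply]
  have hx1 : 0 < x + 1 := by linarith
  rw [← hder]
  constructor
  · refine (le_of_eq ?_).trans (hc.slope_le_deriv (mem_Ioi.mpr hx) (mem_Ioi.mpr hx1)
      (by linarith) hd)
    rw [slope_def_field, add_sub_cancel_left, div_one, h_rec x hx, add_sub_cancel_left]
  · refine (hc.deriv_le_slope (mem_Ioi.mpr hx1) (mem_Ioi.mpr (by linarith : 0 < x + 1 + 1))
      (by linarith) hd).trans (le_of_eq ?_)
    rw [slope_def_field, add_sub_cancel_left, div_one, h_rec _ hx1, add_sub_cancel_left]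

lemma tendsto_log_add_sub_log (y : ℝ) :
    Tendsto (fun N : ℕ => log (y + N) - log N) atTop (𝓝 0) := by
  have h : Tendsto (fun N : ℕ => log (1 + y / N)) atTop (𝓝 0) := by
    have h1 : Tendsto (fun N : ℕ => 1 + y / (N : ℝ)) atTop (𝓝 (1 + 0)) :=
      (tendsto_const_div_atTop_nhds_zero_nat y).const_add 1
    rw [add_zero] at h1
    simpa using h1.log one_ne_zero
  refine h.congr' ?_
  filter_upwards [eventually_gt_atTop 0, tendsto_natCast_atTop_atTop.eventually_gt_atTop (-y)]
    with N hN hy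
  have hN' : (0 : ℝ) < N := Nat.cast_pos.mpr hN
  rw [← log_div (by linarith) hN'.ne']
  congr 1
  field_simp
  ring

/-- Gauss's limit formula for the digamma function. -/
lemma tendsto_log_sub_sum_inv {x : ℝ} (hx : ∀ n : ℕ, x ≠ -(n : ℝ)) :
    Tendsto (fun N : ℕ => log N - ∑ n ∈ Finset.range (N + 1), 1 / (x + n)) atTop
      (𝓝 (logDeriv Gamma x)) := by
  have h0 : Tendsto (fun N : ℕ => logDeriv Gamma (x + N + 1) - log N) atTop (𝓝 0) := by
    refine tendsto_of_tendsto_of_tendsto_of_le_of_le' (tendsto_log_add_sub_log x)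
      (tendsto_log_add_sub_log (x + 1)) ?_ ?_ <;>
    filter_upwards [tendsto_natCast_atTop_atTop.eventually_gt_atTop (-x)] with N hN
    · linarith [(logDeriv_Gamma_mem_Icc (by linarith : 0 < x + N)).1]
    · have := (logDeriv_Gamma_mem_Icc (by linarith : 0 < x + N)).2
      rw [show x + 1 + (N : ℝ) = x + N + 1 by ring]
      linarith
  have h1 := h0.const_sub (logDeriv Gamma x)
  rw [sub_zero] at h1
  refine h1.congr fun N => ?_
  have := logDeriv_Gamma_add_nat hx (N + 1)
  push_cast at this
  rw [add_assoc, this]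
  ring

/-- `f` has a unique zero `r` in `I`, where it passes from negative to positive values. -/
def CrossesZeroAt (f : ℝ → ℝ) (I : Set ℝ) (r : ℝ) : Prop :=
  r ∈ I ∧ f r = 0 ∧ ∀ x ∈ I, (x < r → f x < 0) ∧ (r < x → 0 < f x)

namespace CrossesZeroAt

variable {f : ℝ → ℝ} {I : Set ℝ} {r x : ℝ}

lemma lt_of_neg (h : CrossesZeroAt f I r) (hx : x ∈ I) (hf : f x < 0) : x < r := by
  by_contra! hle
  rcases hle.eq_or_lt with rfl | hlt
  · exact hf.ne h.2.1
  · exact hf.not_gt ((h.2.2 x hx).2 hlt)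

lemma lt_of_pos (h : CrossesZeroAt f I r) (hx : x ∈ I) (hf : 0 < f x) : r < x := by
  by_contra! hle
  rcases hle.eq_or_lt with rfl | hlt
  · exact hf.ne' h.2.1
  · exact hf.not_gt ((h.2.2 x hx).1 hlt)

lemma eq_of_eq_zero (h : CrossesZeroAt f I r) (hx : x ∈ I) (hf : f x = 0) : x = r := by
  rcases lt_trichotomy x r with hlt | heq | hlt
  · exact absurd hf ((h.2.2 x hx).1 hlt).ne
  · exact heq
  · exact absurd hf ((h.2.2 x hx).2 hlt).ne'

/-- Zero crossings are continuous under pointwise convergence. -/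
lemma tendsto {fs : ℕ → ℝ → ℝ} {rs : ℕ → ℝ} (hI : IsOpen I) (h : CrossesZeroAt f I r)
    (hs : ∀ᶠ N in atTop, CrossesZeroAt (fs N) I (rs N))
    (hlim : ∀ x ∈ I, Tendsto (fun N => fs N x) atTop (𝓝 (f x))) :
    Tendsto rs atTop (𝓝 r) := by
  have hnhds : I ∈ 𝓝 r := hI.mem_nhds h.1
  refine tendsto_order.2 ⟨fun a ha => ?_, fun b hb => ?_⟩
  · obtain ⟨x, ⟨hx, hxI⟩⟩ :=
      Filter.nonempty_of_mem (inter_mem (Ioo_mem_nhdsLT ha) (mem_nhdsWithin_of_mem_nhds hnhds))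
    filter_upwards [hs, (hlim x hxI).eventually_lt_const ((h.2.2 x hxI).1 hx.2)] with N hN hneg
    exact hx.1.trans (hN.lt_of_neg hxI hneg)
  · obtain ⟨x, ⟨hx, hxI⟩⟩ :=
      Filter.nonempty_of_mem (inter_mem (Ioo_mem_nhdsGT hb) (mem_nhdsWithin_of_mem_nhds hnhds))
    filter_upwards [hs, (hlim x hxI).eventually_const_lt ((h.2.2 x hxI).2 hx.1)] with N hN hpos
    exact (hN.lt_of_pos hxI hpos).trans hx.2

end CrossesZeroAt

/-- A function which increases from `-∞` to `+∞` between two consecutive simple poles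
crosses zero exactly once. -/
lemma exists_crossesZeroAt_Ioo {h : ℝ → ℝ} {p q : ℝ} (hpq : p < q)
    (hc : ContinuousOn h (Ioo p q))
    (hp : MonotoneOn (fun x => h x + (1 / 2) / (x - p)) (Ioo p q))
    (hq : MonotoneOn (fun x => h x + (1 / 2) / (x - q)) (Ioo p q)) :
    ∃ r, CrossesZeroAt h (Ioo p q) r := by
  have hmono : StrictMonoOn h (Ioo p q) := by
    intro x hx y hy hxy
    have h1 : (1 / 2) / (y - p) < (1 / 2) / (x - p) :=
      div_lt_div_of_pos_left (by norm_num) (by linarith [hx.1]) (by linarith)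
    have h2 := hp hx hy hxy.le
    simp only at h2
    linarith
  set m := (p + q) / 2 with hm
  have hmI : m ∈ Ioo p q := ⟨by linarith, by linarith⟩
  have key : ∀ K : ℝ, ∃ δ : ℝ, 0 < δ ∧ δ < (q - p) / 2 ∧ 0 < K + (1 / 2) / δ := by
    intro K
    have h0 : 0 < (q - p) / 2 := by linarith
    have h1 : 0 < 1 / ((q - p) / 2) := by positivity
    have hD : 0 < 1 / ((q - p) / 2) + 2 * |K| + 1 := by positivity
    refine ⟨1 / (1 / ((q - p) / 2) + 2 * |K| + 1), by positivity, ?_, ?_⟩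
    · rw [div_lt_iff₀ hD]
      have : (q - p) / 2 * (1 / ((q - p) / 2)) = 1 := mul_one_div_cancel h0.ne'
      nlinarith [mul_nonneg h0.le (abs_nonneg K)]
    · rw [div_div_eq_mul_div, div_one]
      linarith [neg_abs_le K]
  obtain ⟨b, hb, hfb⟩ : ∃ b ∈ Ioo p q, 0 < h b := by
    obtain ⟨δ, h1, h2, h3⟩ := key (h m + (1 / 2) / (m - q))
    have hbI : q - δ ∈ Ioo p q := ⟨by linarith, by linarith⟩
    refine ⟨q - δ, hbI, ?_⟩
    have := hq hmI hbI (by linarith)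
    simp only at this
    rw [show q - δ - q = -δ by ring, div_neg] at this
    linarith
  obtain ⟨a, ha, hfa⟩ : ∃ a ∈ Ioo p q, h a < 0 := by
    obtain ⟨δ, h1, h2, h3⟩ := key (-(h m + (1 / 2) / (m - p)))
    have haI : p + δ ∈ Ioo p q := ⟨by linarith, by linarith⟩
    refine ⟨p + δ, haI, ?_⟩
    have := hp haI hmI (by linarith)
    simp only at this
    rw [show p + δ - p = δ by ring] at this
    linarith
  have hab : a < b := (hmono.lt_iff_lt ha hb).1 (hfa.trans hfb)
  obtain ⟨r, hr, hr0⟩ := intermediate_value_Icc hab.le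
    (hc.mono fun x hx => ⟨ha.1.trans_le hx.1, hx.2.trans_lt hb.2⟩) ⟨hfa.le, hfb.le⟩
  have hrI : r ∈ Ioo p q := ⟨ha.1.trans_le hr.1, hr.2.trans_lt hb.2⟩
  refine ⟨r, hrI, hr0, fun x hx => ⟨fun hlt => ?_, fun hlt => ?_⟩⟩
  · exact hr0 ▸ hmono hx hrI hlt
  · exact hr0 ▸ hmono hrI hx hlt

lemma StrictConvexOn.neg_of_nonpos {g : ℝ → ℝ} {s : Set ℝ} (hg : StrictConvexOn ℝ s g)
    {x y z : ℝ} (hx : x ∈ s) (hz : z ∈ s) (hxy : x < y) (hyz : y < z) (hgx : g x ≤ 0)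
    (hgz : g z ≤ 0) : g y < 0 :=
  (hg.lt_on_openSegment hx hz (hxy.trans hyz).ne
    (by rw [openSegment_eq_Ioo (hxy.trans hyz)]; exact ⟨hxy, hyz⟩)).trans_le (max_le hgx hgz)

/-- A strictly convex function on the positive axis with sign pattern `+, -, +` at `1, 2, 4`
has exactly two zeros, one on either side of `2`. -/
lemma exists_crossesZeroAt_of_strictConvexOn {g : ℝ → ℝ} (hg : StrictConvexOn ℝ (Ioi 0) g)
    (h1 : 0 < g 1) (h2 : g 2 < 0) (h4 : 0 < g 4) :
    (∃ r, CrossesZeroAt (fun x => -g x) (Ioo 0 2) r) ∧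
      ∃ s, CrossesZeroAt g (Ioi 2) s := by
  have hc : ContinuousOn g (Ioi 0) := hg.convexOn.continuousOn isOpen_Ioi
  have m2 : (2 : ℝ) ∈ Ioi (0 : ℝ) := by simp
  obtain ⟨r, hr, hr0⟩ := intermediate_value_Ioo' (by norm_num : (1 : ℝ) ≤ 2)
    (hc.mono fun x hx => lt_of_lt_of_le (by norm_num) hx.1) ⟨h2, h1⟩
  obtain ⟨s, hs, hs0⟩ := intermediate_value_Ioo (by norm_num : (2 : ℝ) ≤ 4)
    (hc.mono fun x hx => lt_of_lt_of_le (by norm_num) hx.1) ⟨h2, h4⟩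
  have mr : r ∈ Ioi (0 : ℝ) := mem_Ioi.2 (by linarith [hr.1])
  have ms : s ∈ Ioi (0 : ℝ) := mem_Ioi.2 (by linarith [hs.1])
  refine ⟨⟨r, ⟨mr, hr.2⟩, by simpa using hr0, fun x hx => ⟨fun hlt => ?_, fun hlt => ?_⟩⟩,
    ⟨s, hs.1, hs0, fun x hx => ⟨fun hlt => ?_, fun hlt => ?_⟩⟩⟩
  · by_contra! hle
    exact (hg.neg_of_nonpos (mem_Ioi.2 hx.1) m2 hlt hr.2 (by linarith) h2.le).ne hr0
  · linarith [hg.neg_of_nonpos mr m2 hlt hx.2 hr0.le h2.le]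
  · exact hg.neg_of_nonpos m2 ms hx hlt h2.le hs0.le
  · by_contra! hle
    exact (hg.neg_of_nonpos m2 (mem_Ioi.2 (m2.trans hx)) hs.1 hlt h2.le hle).ne hs0

/-- The function `psiG` on the real axis. -/
noncomputable def psiGReal (x : ℝ) : ℝ :=
  (log (2 * π) + 1) / 2 - x + (x - 1) * logDeriv Gamma x

/-- The rational functions obtained from `psiGReal` by truncating Gauss's limit formula for the
digamma function. -/
noncomputable def psiGApprox (N : ℕ) (x : ℝ) : ℝ :=
  (log (2 * π) - 1) / 2 +
    (x - 1) * (log N - 1 - ∑ n ∈ Finset.range (N + 1), 1 / (x + n))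

lemma psiG_ofReal {x : ℝ} (hx : ∀ n : ℕ, x ≠ -(n : ℝ)) :
    psiG (x : ℂ) = ((psiGReal x : ℝ) : ℂ) := by
  rw [psiG, logDeriv_Gamma_ofReal hx, psiGReal]
  push_cast
  rfl

lemma tendsto_psiGApprox {x : ℝ} (hx : ∀ n : ℕ, x ≠ -(n : ℝ)) :
    Tendsto (fun N => psiGApprox N x) atTop (𝓝 (psiGReal x)) := by
  have h := (((tendsto_log_sub_sum_inv hx).sub_const 1).const_mul (x - 1)).const_add
    ((log (2 * π) - 1) / 2)
  convert h using 2
  · simp only [psiGApprox]; ring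
  · simp only [psiGReal]; ring

lemma one_lt_log_two_pi : 1 < log (2 * π) := by
  rw [lt_log_iff_exp_lt (by positivity)]
  linarith [exp_one_lt_d9, pi_gt_three]

lemma log_two_pi_lt_two : log (2 * π) < 2 := by
  rw [log_lt_iff_lt_exp (by positivity), show (2 : ℝ) = 1 + 1 by norm_num, exp_add]
  nlinarith [exp_one_gt_d9, pi_lt_d2]

lemma psiG_neg_nat_ne_zero (n : ℕ) : psiG (((-(n : ℝ)) : ℝ) : ℂ) ≠ 0 := by
  have h : Complex.Gamma (((-(n : ℝ)) : ℝ) : ℂ) = 0 := by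
    push_cast
    exact Complex.Gamma_neg_nat_eq_zero n
  rw [psiG, logDeriv_apply, h, div_zero, mul_zero, add_zero]
  have : 0 < (log (2 * π) + 1) / 2 - (-(n : ℝ)) := by
    have : (0 : ℝ) ≤ n := n.cast_nonneg
    linarith [one_lt_log_two_pi]
  exact_mod_cast this.ne'

lemma add_nat_mul_pos {k : ℕ} {x y : ℝ} (hx : x ∈ Ioo (-(k + 1) : ℝ) (-k))
    (hy : y ∈ Ioo (-(k + 1) : ℝ) (-k)) (n : ℕ) : 0 < (x + n) * (y + n) := by
  rcases Nat.lt_or_ge k n with h | h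
  · have : (k : ℝ) + 1 ≤ n := by exact_mod_cast h
    exact mul_pos (by linarith [hx.1]) (by linarith [hy.1])
  · have : (n : ℝ) ≤ k := by exact_mod_cast h
    exact mul_pos_of_neg_of_neg (by linarith [hx.2]) (by linarith [hy.2])

lemma ne_neg_nat_of_mem_Ioo {k : ℕ} {x : ℝ} (hx : x ∈ Ioo (-(k + 1) : ℝ) (-k)) (n : ℕ) :
    x ≠ -(n : ℝ) := fun h => by
  have := add_nat_mul_pos hx hx n
  simp [h] at this

lemma ne_neg_nat_of_pos {x : ℝ} (hx : 0 < x) (n : ℕ) : x ≠ -(n : ℝ) := fun h => by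
  have : (0 : ℝ) ≤ n := n.cast_nonneg
  linarith

lemma monotoneOn_psiGApprox_div_add {k j N : ℕ} (hj : j ≤ N) :
    MonotoneOn (fun x => psiGApprox N x / (x - 1) + (1 / 2) / (x + j))
      (Ioo (-(k + 1) : ℝ) (-k)) := by
  set c := (log (2 * π) - 1) / 2 with hc
  have hc0 : 0 < c := by linarith [one_lt_log_two_pi]
  have hc1 : c < 1 / 2 := by linarith [log_two_pi_lt_two]
  set v : ℕ → ℝ := fun n =>
    1 - (if n = 0 then 1 / 2 else 0) - (if n = j then 1 / 2 else 0) with hv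
  have hv0 : ∀ n, 0 ≤ v n := fun n => by
    simp only [hv]; split_ifs <;> norm_num
  have hrep : ∀ x ∈ Ioo (-(k + 1) : ℝ) (-k),
      psiGApprox N x / (x - 1) + (1 / 2) / (x + j) =
        (c / (x - 1) - (1 / 2) / x) + (log N - 1) -
          ∑ n ∈ Finset.range (N + 1), v n / (x + n) := by
    intro x hx
    have hk : (0 : ℝ) ≤ k := k.cast_nonneg
    have hx1 : x - 1 ≠ 0 := by linarith [hx.2]
    have hsum : ∑ n ∈ Finset.range (N + 1), v n / (x + n) =
        ∑ n ∈ Finset.range (N + 1), 1 / (x + n) - (1 / 2) / x - (1 / 2) / (x + j) := by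
      have : ∀ n : ℕ, v n / (x + n) = 1 / (x + n) -
          (if n = 0 then (1 / 2) / (x + n) else 0) -
          (if n = j then (1 / 2) / (x + n) else 0) := fun n => by
        simp only [hv]; split_ifs <;> ring
      simp only [this, Finset.sum_sub_distrib, Finset.sum_ite_eq', Finset.mem_range]
      rw [if_pos (Nat.succ_pos N), if_pos (Nat.lt_succ_of_le hj)]
      simp
    rw [hsum, psiGApprox, ← hc, add_div, mul_div_cancel_left₀ _ hx1]
    ring
  intro x hx y hy hxy
  simp only
  rw [hrep x hx, hrep y hy]
  have hk : (0 : ℝ) ≤ k := k.cast_nonneg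
  have hx0 : x < 0 := by linarith [hx.2]
  have hy0 : y < 0 := by linarith [hy.2]
  have hs : ∑ n ∈ Finset.range (N + 1), v n / (y + n) ≤
      ∑ n ∈ Finset.range (N + 1), v n / (x + n) := by
    refine Finset.sum_le_sum fun n _ => ?_
    have hpos := add_nat_mul_pos hx hy n
    have h1 : x + n ≠ 0 := left_ne_zero_of_mul hpos.ne'
    have h2 : y + n ≠ 0 := right_ne_zero_of_mul hpos.ne'
    have : v n / (x + n) - v n / (y + n) = v n * (y - x) / ((x + n) * (y + n)) := by
      field_simp
      ring
    have : 0 ≤ v n * (y - x) / ((x + n) * (y + n)) :=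
      div_nonneg (mul_nonneg (hv0 n) (by linarith)) hpos.le
    linarith
  have hm : c / (x - 1) - (1 / 2) / x ≤ c / (y - 1) - (1 / 2) / y := by
    have hxy0 : 0 < x * y := mul_pos_of_neg_of_neg hx0 hy0
    have hxy1 : 0 < (x - 1) * (y - 1) := mul_pos_of_neg_of_neg (by linarith) (by linarith)
    have e1 : c / (y - 1) - (1 / 2) / y - (c / (x - 1) - (1 / 2) / x) =
        (y - x) * ((1 / 2) / (x * y) - c / ((x - 1) * (y - 1))) := by
      have h1 : x - 1 ≠ 0 := by linarith
      have h2 : y - 1 ≠ 0 := by linarith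
      have h3 : x ≠ 0 := hx0.ne
      have h4 : y ≠ 0 := hy0.ne
      field_simp
      ring
    have e2 : c / ((x - 1) * (y - 1)) ≤ (1 / 2) / (x * y) :=
      div_le_div₀ (by norm_num) hc1.le hxy0 (by nlinarith)
    have := mul_nonneg (by linarith : 0 ≤ y - x) (by linarith :
      0 ≤ (1 / 2) / (x * y) - c / ((x - 1) * (y - 1)))
    linarith
  linarith

lemma monotoneOn_psiGReal_div_add (k j : ℕ) :
    MonotoneOn (fun x => psiGReal x / (x - 1) + (1 / 2) / (x + j))
      (Ioo (-(k + 1) : ℝ) (-k)) := by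
  intro x hx y hy hxy
  refine le_of_tendsto_of_tendsto
    (((tendsto_psiGApprox (ne_neg_nat_of_mem_Ioo hx)).div_const _).add_const _)
    (((tendsto_psiGApprox (ne_neg_nat_of_mem_Ioo hy)).div_const _).add_const _) ?_
  filter_upwards [eventually_ge_atTop j] with N hN
  exact monotoneOn_psiGApprox_div_add hN hx hy hxy

lemma continuousOn_psiGReal (k : ℕ) : ContinuousOn psiGReal (Ioo (-(k + 1) : ℝ) (-k)) := by
  have hopen : IsOpen (Complex.re ⁻¹' Ioo (-(k + 1) : ℝ) (-k)) :=
    isOpen_Ioo.preimage Complex.continuous_re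
  have hd : DifferentiableOn ℂ Complex.Gamma (Complex.re ⁻¹' Ioo (-(k + 1) : ℝ) (-k)) := by
    intro z hz
    refine (Complex.differentiableAt_Gamma z fun m h => ?_).differentiableWithinAt
    exact ne_neg_nat_of_mem_Ioo hz m (by simp [h])
  have hdd := (hd.deriv hopen).continuousOn
  have hcomp : ContinuousOn (fun x : ℝ => (logDeriv Complex.Gamma (x : ℂ)).re)
      (Ioo (-(k + 1) : ℝ) (-k)) := by
    have hmaps : MapsTo (fun x : ℝ => (x : ℂ)) (Ioo (-(k + 1) : ℝ) (-k))
        (Complex.re ⁻¹' Ioo (-(k + 1) : ℝ) (-k)) := fun x hx => by simpa using hx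
    have h1 := hdd.comp Complex.continuous_ofReal.continuousOn hmaps
    have h2 := hd.continuousOn.comp Complex.continuous_ofReal.continuousOn hmaps
    refine Complex.continuous_re.comp_continuousOn (h1.div h2 fun x hx => ?_)
    exact Complex.Gamma_ne_zero fun m => by exact_mod_cast ne_neg_nat_of_mem_Ioo hx m
  have hlog : ContinuousOn (logDeriv Gamma) (Ioo (-(k + 1) : ℝ) (-k)) :=
    hcomp.congr fun x hx => by
      beta_reduce
      rw [logDeriv_Gamma_ofReal (ne_neg_nat_of_mem_Ioo hx), Complex.ofReal_re]
  unfold psiGReal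
  fun_prop

lemma continuousOn_psiGApprox (N k : ℕ) :
    ContinuousOn (psiGApprox N) (Ioo (-(k + 1) : ℝ) (-k)) := by
  unfold psiGApprox
  have : ∀ n ∈ Finset.range (N + 1),
      ContinuousOn (fun x : ℝ => 1 / (x + n)) (Ioo (-(k + 1) : ℝ) (-k)) := fun n _ =>
    continuousOn_const.div (by fun_prop) fun x hx =>
      left_ne_zero_of_mul (add_nat_mul_pos hx hx n).ne'
  have := continuousOn_finsetSum _ this
  fun_prop

lemma exists_crossesZeroAt_of_monotoneOn_div {g : ℝ → ℝ} {k : ℕ}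
    (hc : ContinuousOn g (Ioo (-(k + 1) : ℝ) (-k)))
    (hmono : ∀ j ∈ ({k, k + 1} : Set ℕ),
      MonotoneOn (fun x => g x / (x - 1) + (1 / 2) / (x + j)) (Ioo (-(k + 1) : ℝ) (-k))) :
    ∃ r, CrossesZeroAt (fun x => -g x) (Ioo (-(k + 1) : ℝ) (-k)) r := by
  have hneg : ∀ x ∈ Ioo (-(k + 1) : ℝ) (-k), x - 1 < 0 := fun x hx => by
    have : (0 : ℝ) ≤ k := k.cast_nonneg
    linarith [hx.2]
  obtain ⟨r, hr, hr0, hr1⟩ := exists_crossesZeroAt_Ioo (h := fun x => g x / (x - 1))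
    (by linarith : (-(k + 1) : ℝ) < -k)
    (hc.div (by fun_prop) fun x hx => (hneg x hx).ne)
    (by simpa only [sub_neg_eq_add, Nat.cast_succ] using hmono (k + 1) (by simp))
    (by simpa only [sub_neg_eq_add] using hmono k (by simp))
  refine ⟨r, hr, ?_, fun x hx => ⟨fun h => ?_, fun h => ?_⟩⟩
  · simpa [(hneg r hr).ne] using hr0
  · have := (hr1 x hx).1 h
    rw [div_neg_iff] at this
    rcases this with h | h <;> linarith [hneg x hx, h.1, h.2]
  · have := (hr1 x hx).2 h
    rw [div_pos_iff] at this
    rcases this with h | h <;> linarith [hneg x hx, h.1, h.2]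

lemma convexOn_div_add_nat {a : ℝ} (ha : 0 ≤ a) (n : ℕ) :
    ConvexOn ℝ (Ioi 0) fun x : ℝ => a / (x + n) := by
  have h := (((convexOn_zpow (𝕜 := ℝ) (-1)).smul ha).translate_left (n : ℝ)).subset
    (s := Ioi 0) (fun x hx => by
      have : (0 : ℝ) ≤ n := n.cast_nonneg
      simp only [mem_preimage, mem_Ioi] at hx ⊢
      linarith) (convex_Ioi 0)
  refine h.congr fun x _ => ?_
  simp [div_eq_mul_inv]

lemma convexOn_affine (a b : ℝ) : ConvexOn ℝ (Ioi 0) fun x : ℝ => a + b * x := by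
  refine ⟨convex_Ioi 0, fun x _ y _ s t _ _ hst => le_of_eq ?_⟩
  simp only [smul_eq_mul]
  linear_combination (-a) * hst

lemma convexOn_psiGApprox_sub_inv (N : ℕ) :
    ConvexOn ℝ (Ioi 0) fun x => psiGApprox N x - x⁻¹ := by
  have hsum : ∀ s : Finset ℕ, ConvexOn ℝ (Ioi 0)
      fun x : ℝ => ∑ n ∈ s, ((n : ℝ) + 2) / (x + (n + 1 : ℕ)) := fun s => by
    classical
    induction s using Finset.induction_on with
    | empty => simpa using convexOn_const (𝕜 := ℝ) (0 : ℝ) (convex_Ioi (0 : ℝ))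
    | insert n s hn ih =>
      simp only [Finset.sum_insert hn]
      exact (convexOn_div_add_nat (by positivity) (n + 1)).add ih
  refine ((convexOn_affine ((log (2 * π) - 1) / 2 - (log N - 1) - 1 - N) (log N - 1)).add
    (hsum (Finset.range N))).congr fun x hx => ?_
  have hx0 : (0 : ℝ) < x := hx
  have hterm : ∀ n : ℕ, (x - 1) * (1 / (x + (n + 1 : ℕ))) =
      1 - ((n : ℝ) + 2) / (x + (n + 1 : ℕ)) := fun n => by
    have : x + ((n + 1 : ℕ) : ℝ) ≠ 0 := by positivity
    field_simp
    push_cast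
    ring
  simp only [Pi.add_apply, psiGApprox]
  rw [mul_sub, Finset.sum_range_succ', mul_add, Finset.mul_sum, Finset.sum_congr rfl
    fun n _ => hterm n, Finset.sum_sub_distrib]
  simp only [Finset.sum_const, Finset.card_range, nsmul_eq_mul, mul_one, Nat.cast_zero, add_zero]
  field_simp
  ring

lemma strictConvexOn_of_convexOn_sub_inv {g : ℝ → ℝ}
    (hg : ConvexOn ℝ (Ioi 0) fun x => g x - x⁻¹) : StrictConvexOn ℝ (Ioi 0) g := by
  refine (hg.add_strictConvexOn (strictConvexOn_zpow (m := -1) (by norm_num)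
    (by norm_num))).congr fun x _ => ?_
  simp

lemma strictConvexOn_psiGApprox (N : ℕ) : StrictConvexOn ℝ (Ioi 0) (psiGApprox N) :=
  strictConvexOn_of_convexOn_sub_inv (convexOn_psiGApprox_sub_inv N)

lemma strictConvexOn_psiGReal : StrictConvexOn ℝ (Ioi 0) psiGReal := by
  refine strictConvexOn_of_convexOn_sub_inv ⟨convex_Ioi 0, fun x hx y hy s t hs ht hst => ?_⟩
  have hlim : ∀ z ∈ Ioi (0 : ℝ),
      Tendsto (fun N => psiGApprox N z - z⁻¹) atTop (𝓝 (psiGReal z - z⁻¹)) := fun z hz =>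
    (tendsto_psiGApprox (ne_neg_nat_of_pos hz)).sub_const _
  exact le_of_tendsto_of_tendsto' (hlim _ (convex_Ioi 0 hx hy hs ht hst))
    (((hlim x hx).const_smul s).add ((hlim y hy).const_smul t))
    fun N => (convexOn_psiGApprox_sub_inv N).2 hx hy hs ht hst

lemma logDeriv_Gamma_one_add_nat (m : ℕ) :
    logDeriv Gamma (1 + m) =
      -eulerMascheroniConstant + ∑ n ∈ Finset.range m, 1 / (1 + (n : ℝ)) := by
  rw [logDeriv_Gamma_add_nat (ne_neg_nat_of_pos one_pos), logDeriv_apply,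
    hasDerivAt_Gamma_one.deriv, Gamma_one, div_one]

lemma psiGReal_one_pos : 0 < psiGReal 1 := by
  simp only [psiGReal]
  linarith [one_lt_log_two_pi]

lemma psiGReal_two_neg : psiGReal 2 < 0 := by
  have h := logDeriv_Gamma_one_add_nat 1
  norm_num at h
  rw [psiGReal, h]
  linarith [log_two_pi_lt_two, one_half_lt_eulerMascheroniConstant]

lemma psiGReal_four_pos : 0 < psiGReal 4 := by
  have h := logDeriv_Gamma_one_add_nat 3
  norm_num [Finset.sum_range_succ] at h
  rw [psiGReal, h]
  linarith [one_lt_log_two_pi, eulerMascheroniConstant_lt_two_thirds]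

/-- The intervals containing exactly one zero of `psiG` each. -/
def zeroInterval : ℕ → Set ℝ
  | 0 => Ioo 0 2
  | 1 => Ioi 2
  | k + 2 => Ioo (-(k + 1)) (-k)

/-- The sign of `psiG` on the right of its zero in `zeroInterval k`. -/
def zeroSign : ℕ → ℝ
  | 1 => 1
  | _ => -1

lemma zeroSign_ne_zero (k : ℕ) : zeroSign k ≠ 0 := by
  unfold zeroSign; split <;> norm_num

lemma isOpen_zeroInterval (k : ℕ) : IsOpen (zeroInterval k) := by
  unfold zeroInterval; split
  exacts [isOpen_Ioo, isOpen_Ioi, isOpen_Ioo]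

lemma ne_neg_nat_of_mem_zeroInterval {k : ℕ} {x : ℝ} (hx : x ∈ zeroInterval k) (n : ℕ) :
    x ≠ -(n : ℝ) := by
  match k with
  | 0 => exact ne_neg_nat_of_pos hx.1 n
  | 1 => exact ne_neg_nat_of_pos (two_pos.trans hx) n
  | k + 2 => exact ne_neg_nat_of_mem_Ioo hx n

lemma exists_mem_zeroInterval {x : ℝ} (hx : ∀ n : ℕ, x ≠ -(n : ℝ)) (h2 : x ≠ 2) :
    ∃ k, x ∈ zeroInterval k := by
  rcases lt_or_ge 0 x with h0 | h0
  · rcases lt_or_gt_of_ne h2 with h | h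
    · exact ⟨0, h0, h⟩
    · exact ⟨1, h⟩
  · refine ⟨⌊-x⌋₊ + 2, ?_, ?_⟩
    · linarith [Nat.lt_floor_add_one (-x)]
    · exact lt_of_le_of_ne (by linarith [Nat.floor_le (by linarith : 0 ≤ -x)]) (hx _)

lemma eq_of_mem_zeroInterval {j k : ℕ} {x : ℝ} (hj : x ∈ zeroInterval j)
    (hk : x ∈ zeroInterval k) : j = k := by
  have hneg : ∀ {i : ℕ}, x ∈ zeroInterval (i + 2) → x < 0 := fun {i} h => by
    have : (0 : ℝ) ≤ i := i.cast_nonneg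
    linarith [h.2]
  have h1 : x ∈ zeroInterval 1 → 2 < x := fun h => h
  match j, k, hj, hk with
  | 0, 0, _, _ => rfl
  | 1, 1, _, _ => rfl
  | 0, 1, h, h' => linarith [h.2, h1 h']
  | 1, 0, h', h => linarith [h.2, h1 h']
  | 0, i + 2, h, h' => linarith [h.1, hneg h']
  | i + 2, 0, h', h => linarith [h.1, hneg h']
  | 1, i + 2, h, h' => linarith [h1 h, hneg h']
  | i + 2, 1, h', h => linarith [h1 h, hneg h']
  | i + 2, l + 2, h, h' =>
    have e1 : (i : ℝ) < l + 1 := by linarith [h.2, h'.1]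
    have e2 : (l : ℝ) < i + 1 := by linarith [h.1, h'.2]
    have e1' : i < l + 1 := by exact_mod_cast e1
    have e2' : l < i + 1 := by exact_mod_cast e2
    omega

lemma exists_crossesZeroAt_psiGReal (k : ℕ) :
    ∃ r, CrossesZeroAt (fun x => zeroSign k * psiGReal x) (zeroInterval k) r := by
  have hpos := exists_crossesZeroAt_of_strictConvexOn strictConvexOn_psiGReal psiGReal_one_pos
    psiGReal_two_neg psiGReal_four_pos
  match k with
  | 0 => simpa [zeroSign, zeroInterval] using hpos.1
  | 1 => simpa [zeroSign, zeroInterval] using hpos.2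
  | k + 2 =>
    simpa only [zeroSign, zeroInterval, neg_one_mul] using
      exists_crossesZeroAt_of_monotoneOn_div (continuousOn_psiGReal k)
        fun j _ => monotoneOn_psiGReal_div_add k j

lemma eventually_exists_crossesZeroAt_psiGApprox :
    ∀ᶠ N in atTop, ∀ k < N + 2,
      ∃ r, CrossesZeroAt (fun x => zeroSign k * psiGApprox N x) (zeroInterval k) r := by
  have hlim : ∀ x : ℝ, 0 < x → Tendsto (fun N => psiGApprox N x) atTop (𝓝 (psiGReal x)) :=
    fun x hx => tendsto_psiGApprox (ne_neg_nat_of_pos hx)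
  filter_upwards [(hlim 1 (by norm_num)).eventually_const_lt psiGReal_one_pos,
    (hlim 2 (by norm_num)).eventually_lt_const psiGReal_two_neg,
    (hlim 4 (by norm_num)).eventually_const_lt psiGReal_four_pos] with N h1 h2 h4 k hk
  have hpos := exists_crossesZeroAt_of_strictConvexOn (strictConvexOn_psiGApprox N) h1 h2 h4
  match k, hk with
  | 0, _ => simpa [zeroSign, zeroInterval] using hpos.1
  | 1, _ => simpa [zeroSign, zeroInterval] using hpos.2
  | k + 2, hk =>
    simpa only [zeroSign, zeroInterval, neg_one_mul] using
      exists_crossesZeroAt_of_monotoneOn_div (continuousOn_psiGApprox N k)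
        fun j hj => monotoneOn_psiGApprox_div_add (by
          rcases hj with rfl | hj
          · omega
          · rw [mem_singleton_iff] at hj; omega)

/-- For `f` with constant coefficient `1`, this is `-4` times the coefficient of `X ^ 4` in
`log f`. -/
noncomputable def logCoeffFour (f : PowerSeries ℝ) : ℝ :=
  f.coeff 1 ^ 4 - 4 * f.coeff 1 ^ 2 * f.coeff 2 + 2 * f.coeff 2 ^ 2 +
    4 * f.coeff 1 * f.coeff 3 - 4 * f.coeff 4

lemma logCoeffFour_mul {f g : PowerSeries ℝ} (hf : f.coeff 0 = 1) (hg : g.coeff 0 = 1) :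
    logCoeffFour (f * g) = logCoeffFour f + logCoeffFour g := by
  simp only [logCoeffFour, PowerSeries.coeff_mul,
    Finset.Nat.sum_antidiagonal_eq_sum_range_succ_mk, Finset.sum_range_succ,
    Finset.sum_range_zero, Nat.sub_zero, Nat.sub_self, hf, hg, Nat.reduceSub]
  ring

lemma coeff_zero_one_add (a : ℝ) :
    PowerSeries.coeff 0 (1 + PowerSeries.C a * PowerSeries.X) = 1 := by
  simp

lemma logCoeffFour_one_add (a : ℝ) :
    logCoeffFour (1 + PowerSeries.C a * PowerSeries.X) = a ^ 4 := by
  simp [logCoeffFour, PowerSeries.coeff_one]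

lemma logCoeffFour_prod {ι : Type*} (s : Finset ι) (a : ι → ℝ) :
    PowerSeries.coeff 0 (∏ i ∈ s, (1 + PowerSeries.C (a i) * PowerSeries.X)) = 1 ∧
      logCoeffFour (∏ i ∈ s, (1 + PowerSeries.C (a i) * PowerSeries.X)) = ∑ i ∈ s, a i ^ 4 := by
  classical
  induction s using Finset.induction_on with
  | empty => simp [logCoeffFour, PowerSeries.coeff_one]
  | insert i s hi ih =>
    rw [Finset.prod_insert hi, Finset.sum_insert hi]
    refine ⟨?_, ?_⟩
    · rw [PowerSeries.coeff_mul, Finset.Nat.antidiagonal_zero, Finset.sum_singleton,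
        coeff_zero_one_add, ih.1, one_mul]
    · rw [logCoeffFour_mul (coeff_zero_one_add _) ih.1, logCoeffFour_one_add, ih.2]

open Polynomial in
/-- The sum of the inverse fourth powers of the roots of a polynomial with simple roots, in terms
of its low order coefficients. -/
lemma logCoeffFour_eq_sum_roots {ι : Type*} {s : Finset ι} {r : ι → ℝ} {P : ℝ[X]}
    (hinj : Set.InjOn r s) (hr : ∀ i ∈ s, r i ≠ 0) (hP : ∀ i ∈ s, P.eval (r i) = 0)
    (h0 : P.eval 0 = 1) (hdeg : P.natDegree ≤ s.card) :
    logCoeffFour (P : PowerSeries ℝ) = ∑ i ∈ s, 1 / r i ^ 4 := by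
  classical
  have hdeg' : (∏ i ∈ s, (1 + C (-1 / r i) * X)).natDegree ≤ s.card := by
    refine (natDegree_prod_le _ _).trans ?_
    refine (Finset.sum_le_card_nsmul s _ 1 fun i _ => ?_).trans (by simp)
    compute_degree
  have hnot : (0 : ℝ) ∉ s.image r := fun h => by
    obtain ⟨i, hi, h⟩ := Finset.mem_image.1 h
    exact hr i hi h
  have hcard : (insert 0 (s.image r)).card = s.card + 1 := by
    rw [Finset.card_insert_of_notMem hnot, Finset.card_image_of_injOn hinj]
  have hfac : P = ∏ i ∈ s, (1 + C (-1 / r i) * X) := by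
    refine eq_of_degrees_lt_of_eval_finset_eq (insert 0 (s.image r)) ?_ ?_ fun x hx => ?_
    · rw [hcard]
      exact degree_le_natDegree.trans_lt (by exact_mod_cast Nat.lt_succ_of_le hdeg)
    · rw [hcard]
      exact degree_le_natDegree.trans_lt (by exact_mod_cast Nat.lt_succ_of_le hdeg')
    · rcases Finset.mem_insert.1 hx with rfl | hx
      · simp [eval_prod, h0]
      · obtain ⟨i, hi, rfl⟩ := Finset.mem_image.1 hx
        rw [hP i hi, eval_prod, Finset.prod_eq_zero hi]
        have := hr i hi
        simp
        field_simp
        ring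
  have hcoe : (P : PowerSeries ℝ) =
      ∏ i ∈ s, (1 + PowerSeries.C (-1 / r i) * PowerSeries.X) := by
    rw [hfac, ← coeToPowerSeries.ringHom_apply, map_prod]
    simp
  rw [hcoe, (logCoeffFour_prod s _).2]
  exact Finset.sum_congr rfl fun i _ => by ring

open Polynomial in
/-- The numerator of `x * (c + (x - 1) * (A - ∑ n ∈ range (N + 1), 1 / (x + n)))` over the common
denominator `∏ n ∈ range N, (1 + x / (n + 1))`. -/
noncomputable def approxNumerator (c A : ℝ) (N : ℕ) : ℝ[X] :=
  (C c * X + (X ^ 2 - X) * C A - (X - 1)) *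
      ∏ n ∈ Finset.range N, (1 + C (1 / ((n : ℝ) + 1)) * X) -
    (X - 1) * ∑ m ∈ Finset.range N, C (1 / ((m : ℝ) + 1)) * X *
      ∏ n ∈ (Finset.range N).erase m, (1 + C (1 / ((n : ℝ) + 1)) * X)

open Polynomial in
lemma eval_approxNumerator (c A : ℝ) (N : ℕ) {x : ℝ} (hx : ∀ n : ℕ, x ≠ -(n : ℝ)) :
    (approxNumerator c A N).eval x =
      x * (c + (x - 1) * (A - ∑ n ∈ Finset.range (N + 1), 1 / (x + n))) *
        ∏ n ∈ Finset.range N, (1 + 1 / ((n : ℝ) + 1) * x) := by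
  have hne : ∀ n : ℕ, 1 + 1 / ((n : ℝ) + 1) * x ≠ 0 := fun n h => by
    have hn : (n : ℝ) + 1 ≠ 0 := by positivity
    refine hx (n + 1) ?_
    field_simp at h
    push_cast
    linarith
  have hsum : ∀ m ∈ Finset.range N, 1 / ((m : ℝ) + 1) * x *
      ∏ n ∈ (Finset.range N).erase m, (1 + 1 / ((n : ℝ) + 1) * x) =
      x * (1 / (x + (m + 1 : ℕ))) * ∏ n ∈ Finset.range N, (1 + 1 / ((n : ℝ) + 1) * x) := by
    intro m hm
    rw [← Finset.mul_prod_erase _ _ hm, ← mul_assoc]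
    congr 1
    have h1 : (m : ℝ) + 1 ≠ 0 := by positivity
    have h2 : x + ((m + 1 : ℕ) : ℝ) ≠ 0 := fun h => hx (m + 1) (by linarith)
    push_cast at h2 ⊢
    field_simp
    ring
  have hx0 : x ≠ 0 := by simpa using hx 0
  simp only [approxNumerator, eval_sub, eval_add, eval_mul, eval_pow, eval_X, eval_C, eval_one,
    eval_prod, eval_finsetSum]
  rw [Finset.sum_congr rfl hsum, ← Finset.sum_mul, ← Finset.mul_sum, Finset.sum_range_succ']
  simp only [Nat.cast_zero, add_zero]
  have : x * (1 / x) = 1 := mul_one_div_cancel hx0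
  linear_combination ((x - 1) * ∏ n ∈ Finset.range N, (1 + 1 / ((n : ℝ) + 1) * x)) * this

open Polynomial in
lemma natDegree_approxNumerator_le (c A : ℝ) (N : ℕ) :
    (approxNumerator c A N).natDegree ≤ N + 2 := by
  have hprod : ∀ s : Finset ℕ,
      (∏ n ∈ s, (1 + C (1 / ((n : ℝ) + 1)) * X)).natDegree ≤ s.card := fun s => by
    refine (natDegree_prod_le _ _).trans ?_
    refine (Finset.sum_le_card_nsmul s _ 1 fun i _ => ?_).trans (by simp)
    compute_degree
  refine (natDegree_sub_le _ _).trans (max_le ?_ ?_)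
  · refine natDegree_mul_le.trans ?_
    have h1 : (C c * X + (X ^ 2 - X) * C A - (X - 1)).natDegree ≤ 2 := by compute_degree
    have h2 := hprod (Finset.range N)
    rw [Finset.card_range] at h2
    omega
  · refine natDegree_mul_le.trans ?_
    have h1 : (X - 1 : ℝ[X]).natDegree ≤ 1 := by compute_degree
    have h2 : (∑ m ∈ Finset.range N, C (1 / ((m : ℝ) + 1)) * X *
        ∏ n ∈ (Finset.range N).erase m, (1 + C (1 / ((n : ℝ) + 1)) * X)).natDegree ≤ N + 1 := by
      refine natDegree_sum_le_of_forall_le _ _ fun m _ => natDegree_mul_le.trans ?_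
      have h3 : (C (1 / ((m : ℝ) + 1)) * X).natDegree ≤ 1 := by compute_degree
      have h4 := (hprod ((Finset.range N).erase m)).trans (Finset.card_erase_le)
      rw [Finset.card_range] at h4
      omega
    omega

lemma coeff_one_add_mul_mk (a : ℝ) :
    PowerSeries.mk (fun j => (-a) ^ j) * (1 + PowerSeries.C a * PowerSeries.X) = 1 := by
  ext n
  rw [mul_add, mul_one, ← mul_assoc, map_add]
  cases n with
  | zero => simp
  | succ n =>
    rw [PowerSeries.coeff_succ_mul_X, PowerSeries.coeff_mul_C]
    simp [PowerSeries.coeff_one]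
    ring

lemma logCoeffFour_approxNumerator (c A : ℝ) (N : ℕ) {H : ℕ → ℝ}
    (hH : ∀ j, H j = ∑ n ∈ Finset.range N, (1 / ((n : ℝ) + 1)) ^ j) :
    logCoeffFour (approxNumerator c A N : PowerSeries ℝ) =
      (c - A - 1 + H 1) ^ 4 - 4 * (c - A - 1 + H 1) ^ 2 * (A - H 1 - H 2) +
        2 * (A - H 1 - H 2) ^ 2 + 4 * (c - A - 1 + H 1) * (H 2 + H 3) +
        4 * (H 3 + H 4) + H 4 := by
  set a : ℕ → ℝ := fun n => 1 / ((n : ℝ) + 1) with ha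
  set T : PowerSeries ℝ := ∑ m ∈ Finset.range N,
    PowerSeries.C (a m) * PowerSeries.mk (fun j => (-a m) ^ j) with hT
  set V : PowerSeries ℝ := PowerSeries.C c * PowerSeries.X +
    (PowerSeries.X ^ 2 - PowerSeries.X) * PowerSeries.C A - (PowerSeries.X - 1) -
    (PowerSeries.X - 1) * (PowerSeries.X * T) with hV
  have hTc : ∀ j, PowerSeries.coeff j T = (-1) ^ j * H (j + 1) := fun j => by
    rw [hT, map_sum, hH, Finset.mul_sum]
    refine Finset.sum_congr rfl fun m _ => ?_
    rw [PowerSeries.coeff_C_mul, PowerSeries.coeff_mk, neg_pow]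
    ring
  have hfac : (approxNumerator c A N : PowerSeries ℝ) =
      V * ∏ n ∈ Finset.range N, (1 + PowerSeries.C (a n) * PowerSeries.X) := by
    have hm : ∀ m ∈ Finset.range N, PowerSeries.C (a m) * PowerSeries.X *
        ∏ n ∈ (Finset.range N).erase m, (1 + PowerSeries.C (a n) * PowerSeries.X) =
        PowerSeries.X * (PowerSeries.C (a m) * PowerSeries.mk (fun j => (-a m) ^ j)) *
          ∏ n ∈ Finset.range N, (1 + PowerSeries.C (a n) * PowerSeries.X) := fun m hm => by
      rw [← Finset.mul_prod_erase _ _ hm]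
      linear_combination (-PowerSeries.C (a m) * PowerSeries.X *
        ∏ n ∈ (Finset.range N).erase m, (1 + PowerSeries.C (a n) * PowerSeries.X)) *
        coeff_one_add_mul_mk (a m)
    have hcoe : (approxNumerator c A N : PowerSeries ℝ) =
        (PowerSeries.C c * PowerSeries.X +
          (PowerSeries.X ^ 2 - PowerSeries.X) * PowerSeries.C A - (PowerSeries.X - 1)) *
          ∏ n ∈ Finset.range N, (1 + PowerSeries.C (a n) * PowerSeries.X) -
        (PowerSeries.X - 1) * ∑ m ∈ Finset.range N, PowerSeries.C (a m) * PowerSeries.X *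
          ∏ n ∈ (Finset.range N).erase m, (1 + PowerSeries.C (a n) * PowerSeries.X) := by
      rw [approxNumerator, ← Polynomial.coeToPowerSeries.ringHom_apply]
      simp only [map_sub, map_add, map_mul, map_prod, map_sum, map_pow, map_one,
        Polynomial.coeToPowerSeries.ringHom_apply, Polynomial.coe_X, Polynomial.coe_C, ha]
    rw [hcoe, Finset.sum_congr rfl hm, ← Finset.sum_mul, ← Finset.mul_sum, hV, hT]
    ring
  have hV' : V = 1 + PowerSeries.C (c - A - 1) * PowerSeries.X +
      PowerSeries.C A * PowerSeries.X ^ 2 + T * PowerSeries.X - T * PowerSeries.X ^ 2 := by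
    rw [hV]
    simp only [map_sub, map_one]
    ring
  have hX : ∀ n, PowerSeries.coeff n V = PowerSeries.coeff n (1 : PowerSeries ℝ) +
      (c - A - 1) * PowerSeries.coeff n (PowerSeries.X : PowerSeries ℝ) +
      A * PowerSeries.coeff n (PowerSeries.X ^ 2 : PowerSeries ℝ) +
      PowerSeries.coeff n (T * PowerSeries.X) - PowerSeries.coeff n (T * PowerSeries.X ^ 2) := by
    intro n
    rw [hV', map_sub, map_add, map_add, map_add, PowerSeries.coeff_C_mul, PowerSeries.coeff_C_mul]
  have h0 : PowerSeries.coeff 0 V = 1 := by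
    rw [hX]
    simp [PowerSeries.coeff_X_pow]
  have hpow : H 4 = ∑ n ∈ Finset.range N, a n ^ 4 := hH 4
  rw [hfac, logCoeffFour_mul h0 (logCoeffFour_prod _ _).1, (logCoeffFour_prod _ _).2, ← hpow]
  simp only [logCoeffFour, hX, PowerSeries.coeff_one, PowerSeries.coeff_X, PowerSeries.coeff_X_pow,
    PowerSeries.coeff_mul_X_pow', PowerSeries.coeff_succ_mul_X, hTc]
  norm_num
  ring

/-- Limits of generalized harmonic numbers. -/
lemma tendsto_sum_inv_pow {j : ℕ} {a : ℝ} (hj : j ≠ 0)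
    (h : HasSum (fun n : ℕ => (1 : ℝ) / (n : ℝ) ^ j) a) :
    Tendsto (fun N : ℕ => ∑ n ∈ Finset.range N, (1 / ((n : ℝ) + 1)) ^ j) atTop (𝓝 a) := by
  have h1 := ((hasSum_nat_add_iff' 1).2 h).tendsto_sum_nat
  simpa [hj, div_pow] using h1

lemma tendsto_log_sub_one_sub_harmonic :
    Tendsto (fun N : ℕ => log N - 1 - ∑ n ∈ Finset.range N, (1 / ((n : ℝ) + 1)) ^ 1) atTop
      (𝓝 (-1 - eulerMascheroniConstant)) := by
  have h := tendsto_harmonic_sub_log.const_sub (-1)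
  refine h.congr fun N => ?_
  simp only [harmonic, pow_one, one_div]
  push_cast
  ring

/-- The value of the sum of the inverse fourth powers of the zeros of `psiG`, with
`c = (log (2π) - 1) / 2`, `B = -1 - γ` and `ζ(2), ζ(3), ζ(4)` inserted. -/
noncomputable def inversePowerSum (c B z₂ z₃ z₄ : ℝ) : ℝ :=
  (c - B - 1) ^ 4 - 4 * (c - B - 1) ^ 2 * (B - z₂) + 2 * (B - z₂) ^ 2 +
    4 * (c - B - 1) * (z₂ + z₃) + 4 * (z₃ + z₄) + z₄

lemma sum_inv_pow_four_psiGApprox {N : ℕ} {r : ℕ → ℝ}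
    (hr : ∀ k < N + 2,
      CrossesZeroAt (fun x => zeroSign k * psiGApprox N x) (zeroInterval k) (r k))
    {H : ℕ → ℝ} (hH : ∀ j, H j = ∑ n ∈ Finset.range N, (1 / ((n : ℝ) + 1)) ^ j) :
    ∑ k ∈ Finset.range (N + 2), 1 / r k ^ 4 =
      inversePowerSum ((log (2 * π) - 1) / 2) (log N - 1 - H 1) (H 2) (H 3) (H 4) := by
  have hne : ∀ k ∈ Finset.range (N + 2), ∀ n : ℕ, r k ≠ -(n : ℝ) := fun k hk =>
    ne_neg_nat_of_mem_zeroInterval (hr k (Finset.mem_range.1 hk)).1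
  have hinj : Set.InjOn r (Finset.range (N + 2) : Set ℕ) := fun j hj k hk h =>
    eq_of_mem_zeroInterval (hr j (by simpa using hj)).1
      (h.symm ▸ (hr k (by simpa using hk)).1)
  have hroot : ∀ k ∈ Finset.range (N + 2),
      (approxNumerator ((log (2 * π) - 1) / 2) (log N - 1) N).eval (r k) = 0 := fun k hk => by
    have h := (mul_eq_zero.1 (hr k (Finset.mem_range.1 hk)).2.1).resolve_left (zeroSign_ne_zero k)
    rw [psiGApprox] at h
    rw [eval_approxNumerator _ _ _ (hne k hk), h, mul_zero, zero_mul]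
  have hconst : (approxNumerator ((log (2 * π) - 1) / 2) (log N - 1) N).eval 0 = 1 := by
    simp [approxNumerator, Polynomial.eval_prod, Polynomial.eval_finsetSum]
  rw [← logCoeffFour_eq_sum_roots hinj (fun k hk => by simpa using hne k hk 0) hroot hconst
      (by simpa using natDegree_approxNumerator_le _ _ N),
    logCoeffFour_approxNumerator _ _ _ hH, inversePowerSum]
  ring

lemma inv_pow_four_le_of_mem_zeroInterval {k : ℕ} {x : ℝ} (hx : x ∈ zeroInterval (k + 3)) :
    1 / x ^ 4 ≤ 1 / ((k : ℝ) + 1) ^ 4 := by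
  have h : x < -((k + 1 : ℕ) : ℝ) := hx.2
  push_cast at h
  rw [← Even.neg_pow (by decide : Even 4) x]
  exact one_div_le_one_div_of_le (by positivity) (pow_le_pow_left₀ (by positivity) (by linarith) 4)

/-- The sum of the inverse fourth powers of the zeros of `psiG`, enumerated by the intervals
containing them. -/
lemma hasSum_inv_pow_four {ρ : ℕ → ℝ}
    (hρ : ∀ k, CrossesZeroAt (fun x => zeroSign k * psiGReal x) (zeroInterval k) (ρ k))
    {z₃ : ℝ} (hz₃ : HasSum (fun n : ℕ => (1 : ℝ) / (n : ℝ) ^ 3) z₃) :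
    HasSum (fun k => 1 / ρ k ^ 4)
      (inversePowerSum ((log (2 * π) - 1) / 2) (-1 - eulerMascheroniConstant) (π ^ 2 / 6) z₃
        (π ^ 4 / 90)) := by
  have hex : ∀ N k, ∃ r, (∀ k < N + 2, ∃ r,
      CrossesZeroAt (fun x => zeroSign k * psiGApprox N x) (zeroInterval k) r) → k < N + 2 →
      CrossesZeroAt (fun x => zeroSign k * psiGApprox N x) (zeroInterval k) r := by
    intro N k
    by_cases h : (∀ k < N + 2, ∃ r,
      CrossesZeroAt (fun x => zeroSign k * psiGApprox N x) (zeroInterval k) r) ∧ k < N + 2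
    · obtain ⟨r, hr⟩ := h.1 k h.2
      exact ⟨r, fun _ _ => hr⟩
    · exact ⟨0, fun h1 h2 => absurd ⟨h1, h2⟩ h⟩
  choose r hr using hex
  have hev : ∀ᶠ N in atTop, ∀ k < N + 2,
      CrossesZeroAt (fun x => zeroSign k * psiGApprox N x) (zeroInterval k) (r N k) := by
    filter_upwards [eventually_exists_crossesZeroAt_psiGApprox] with N hN k hk
    exact hr N k hN hk
  set f : ℕ → ℕ → ℝ := fun N k => if k < N + 2 then 1 / r N k ^ 4 else 0 with hf
  have hlt : ∀ k, ∀ᶠ N in atTop, k < N + 2 := fun k => by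
    filter_upwards [eventually_ge_atTop k] with N hN
    omega
  have hlim : ∀ k, Tendsto (fun N => f N k) atTop (𝓝 (1 / ρ k ^ 4)) := by
    intro k
    have hρ0 : ρ k ≠ 0 := by simpa using ne_neg_nat_of_mem_zeroInterval (hρ k).1 0
    have hrk : Tendsto (fun N => r N k) atTop (𝓝 (ρ k)) :=
      (hρ k).tendsto (isOpen_zeroInterval k)
        (by filter_upwards [hev, hlt k] with N hN hk using hN k hk)
        fun x hx => (tendsto_psiGApprox (ne_neg_nat_of_mem_zeroInterval hx)).const_mul _
    refine (tendsto_const_nhds.div (hrk.pow 4) (pow_ne_zero 4 hρ0)).congr' ?_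
    filter_upwards [hlt k] with N hN
    simp only [hf, if_pos hN, Pi.div_apply]
  set b : ℕ → ℝ := fun k =>
    if k < 3 then 1 / ρ k ^ 4 + 1 else 1 / (((k - 3 : ℕ) : ℝ) + 1) ^ 4 with hb
  have hbsum : Summable b := by
    refine (summable_nat_add_iff 3).1 ?_
    have h := (summable_nat_add_iff 1).2 hasSum_zeta_four.summable
    refine h.congr fun k => ?_
    simp [hb]
  have hbound : ∀ᶠ N in atTop, ∀ k, ‖f N k‖ ≤ b k := by
    have hsmall : ∀ k, ∀ᶠ N in atTop, f N k ≤ 1 / ρ k ^ 4 + 1 := fun k =>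
      ((hlim k).eventually_lt_const (lt_add_one _)).mono fun _ h => h.le
    filter_upwards [hev, hsmall 0, hsmall 1, hsmall 2] with N hN h0 h1 h2 k
    have hnonneg : 0 ≤ f N k := by
      simp only [hf]; split_ifs
      · exact one_div_nonneg.2 (Even.pow_nonneg (by decide) _)
      · exact le_rfl
    rw [Real.norm_of_nonneg hnonneg]
    match k with
    | 0 => simpa [hb] using h0
    | 1 => simpa [hb] using h1
    | 2 => simpa [hb] using h2
    | k + 3 =>
      simp only [hb, hf, Nat.add_sub_cancel, if_neg (by omega : ¬ k + 3 < 3)]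
      split_ifs with hk
      · exact inv_pow_four_le_of_mem_zeroInterval (hN _ hk).1
      · positivity
  have hsum : Summable fun k => 1 / ρ k ^ 4 :=
    Summable.of_norm_bounded hbsum fun k =>
      le_of_tendsto (hlim k).norm (hbound.mono fun N hN => hN k)
  have htend := tendsto_tsum_of_dominated_convergence hbsum hlim hbound
  have hvalue : Tendsto (fun N => ∑' k, f N k) atTop
      (𝓝 (inversePowerSum ((log (2 * π) - 1) / 2) (-1 - eulerMascheroniConstant) (π ^ 2 / 6) z₃
        (π ^ 4 / 90))) := by
    have hcont : Continuous fun p : ℝ × ℝ × ℝ × ℝ =>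
        inversePowerSum ((log (2 * π) - 1) / 2) p.1 p.2.1 p.2.2.1 p.2.2.2 := by
      unfold inversePowerSum
      fun_prop
    refine ((hcont.tendsto (-1 - eulerMascheroniConstant, π ^ 2 / 6, z₃, π ^ 4 / 90)).comp
      (tendsto_log_sub_one_sub_harmonic.prodMk_nhds
        ((tendsto_sum_inv_pow two_ne_zero hasSum_zeta_two).prodMk_nhds
          ((tendsto_sum_inv_pow three_ne_zero hz₃).prodMk_nhds
            (tendsto_sum_inv_pow four_ne_zero hasSum_zeta_four))))).congr' ?_
    filter_upwards [hev] with N hN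
    rw [tsum_eq_sum (s := Finset.range (N + 2)) fun k hk => by
      simp only [hf, if_neg (fun h => hk (Finset.mem_range.2 h))]]
    rw [Finset.sum_congr rfl fun k hk => by simp only [hf, if_pos (Finset.mem_range.1 hk)]; rfl,
      sum_inv_pow_four_psiGApprox hN fun _ => rfl]
    rfl
  exact tendsto_nhds_unique htend hvalue ▸ hsum.hasSum

/-- The real zeros of `psiG` are exactly the zeros in the intervals `zeroInterval k`. -/
lemma psiG_eq_zero_iff {ρ : ℕ → ℝ}
    (hρ : ∀ k, CrossesZeroAt (fun x => zeroSign k * psiGReal x) (zeroInterval k) (ρ k)) (x : ℝ) :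
    psiG (x : ℂ) = 0 ↔ ∃ k, ρ k = x := by
  constructor
  · intro h
    have hx : ∀ n : ℕ, x ≠ -(n : ℝ) := fun n hn => psiG_neg_nat_ne_zero n (hn ▸ h)
    rw [psiG_ofReal hx, Complex.ofReal_eq_zero] at h
    obtain ⟨k, hk⟩ := exists_mem_zeroInterval hx fun h2 => psiGReal_two_neg.ne (h2 ▸ h)
    exact ⟨k, ((hρ k).eq_of_eq_zero hk (by simp [h])).symm⟩
  · rintro ⟨k, rfl⟩
    rw [psiG_ofReal (ne_neg_nat_of_mem_zeroInterval (hρ k).1),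
      (mul_eq_zero.1 (hρ k).2.1).resolve_left (zeroSign_ne_zero k), Complex.ofReal_zero]

/-- Any enumeration of the zeros of `psiG` without repetition has the same sum of inverse fourth
powers. -/
lemma hasSum_inv_pow_four_of_enumeration {β : ℕ → ℝ} (hinj : Function.Injective β)
    (hzero : ∀ k : ℕ, psiG (β k : ℂ) = 0)
    (henum : ∀ x : ℝ, (∀ n : ℕ, x ≠ -(n : ℝ)) → psiG (x : ℂ) = 0 → ∃ k : ℕ, β k = x)
    {z₃ : ℝ} (hz₃ : HasSum (fun n : ℕ => (1 : ℝ) / (n : ℝ) ^ 3) z₃) :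
    HasSum (fun k => 1 / β k ^ 4)
      (inversePowerSum ((log (2 * π) - 1) / 2) (-1 - eulerMascheroniConstant) (π ^ 2 / 6) z₃
        (π ^ 4 / 90)) := by
  choose ρ hρ using exists_crossesZeroAt_psiGReal
  choose e he using fun k => (psiG_eq_zero_iff hρ (β k)).1 (hzero k)
  have hbij : Function.Bijective e := by
    refine ⟨fun i j hij => hinj ?_, fun k => ?_⟩
    · rw [← he i, ← he j, hij]
    · obtain ⟨j, hj⟩ := henum (ρ k) (ne_neg_nat_of_mem_zeroInterval (hρ k).1)
        ((psiG_eq_zero_iff hρ _).2 ⟨k, rfl⟩)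
      refine ⟨j, eq_of_mem_zeroInterval (hρ (e j)).1 ?_⟩
      rw [he j, hj]
      exact (hρ k).1
  refine ((Equiv.ofBijective e hbij).hasSum_iff.2 (hasSum_inv_pow_four hρ hz₃)).congr_fun ?_
  intro k
  simp [he]

end

open Real in
/-- With `L = log 2π`, `∑_{k=0}^∞ 1/β_k⁴ = 2ζ(3)(L+1) + γ⁴ + π⁴/9 + (π²/6)(L²+3)
+ 2γ³(L+1) + (γ/6)[24ζ(3) + 3 + 4π²(L+1) + 3L(L²-L+7)] + (γ²/6)[9L² + 6L + 4π² + 21]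
+ (1/16)[L⁴ - 4L³ + 22L² - 36L + 49]`, where `β` is the strictly decreasing enumeration
of the zeros of `ψ_G` and `ζ` is the Riemann zeta function. -/
theorem sum_inv_pow_four_psiG_zeros
    (β : ℕ → ℝ) (hanti : StrictAnti β)
    (hzero : ∀ k : ℕ, psiG (β k : ℂ) = 0)
    (henum : ∀ x : ℝ, (∀ n : ℕ, x ≠ -(n : ℝ)) → psiG (x : ℂ) = 0 → ∃ k : ℕ, β k = x) :
    Summable (fun k : ℕ => 1 / (β k) ^ 4) ∧
    ∀ L : ℂ, L = (Real.log (2 * π) : ℂ) →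
      ((∑' k : ℕ, 1 / (β k) ^ 4 : ℝ) : ℂ) =
        2 * riemannZeta 3 * (L + 1) + (eulerMascheroniConstant : ℂ) ^ 4 + (π : ℂ) ^ 4 / 9 +
          ((π : ℂ) ^ 2 / 6) * (L ^ 2 + 3) + 2 * (eulerMascheroniConstant : ℂ) ^ 3 * (L + 1) +
          ((eulerMascheroniConstant : ℂ) / 6) *
            (24 * riemannZeta 3 + 3 + 4 * (π : ℂ) ^ 2 * (L + 1) +
              3 * L * (L ^ 2 - L + 7)) +
          ((eulerMascheroniConstant : ℂ) ^ 2 / 6) *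
            (9 * L ^ 2 + 6 * L + 4 * (π : ℂ) ^ 2 + 21) +
          (1 / 16) * (L ^ 4 - 4 * L ^ 3 + 22 * L ^ 2 - 36 * L + 49) := by
  have hz₃ : Summable fun n : ℕ => (1 : ℝ) / (n : ℝ) ^ 3 :=
    Real.summable_one_div_nat_pow.2 (by norm_num)
  have hζ : riemannZeta 3 = ((∑' n : ℕ, (1 : ℝ) / (n : ℝ) ^ 3 : ℝ) : ℂ) := by
    have := zeta_nat_eq_tsum_of_gt_one (by norm_num : 1 < 3)
    push_cast at this ⊢
    exact this
  have hsum := hasSum_inv_pow_four_of_enumeration hanti.injective hzero henum hz₃.hasSum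
  refine ⟨hsum.summable, fun L hL => ?_⟩
  rw [hsum.tsum_eq, hL, hζ, inversePowerSum]
  push_cast
  ring
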